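/- Let q : [0,1] → ℝ be a monotone nondecreasing integrable function satisfying the symmetry condition q(τ) + q(1 − τ) = 2μ for all τ ∈ [0,1] (for some μ ∈ ℝ), and let 1/2 ≤ α < β ≤ 1. Then the mean of q over the whole interval equals μ, i.e., ∫₀¹ q(τ) dτ = μ, and the mean of q over the upper subinterval dominates it: (1/(β − α)) · ∫_α^β q(τ) dτ ≥ μ = ∫₀¹ q(τ) dτ. -/

import Mathlib

/-- overestimation for symmetric distributions: Let
`q : [0,1] → ℝ` be a monotone nondecreasing integrable quantile function with
the symmetry `q(τ) + q(1−τ) = 2μ` on `[0,1]`, and let `1/2 ≤ α < β ≤ 1`.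
Then `∫₀¹ q = μ` and the mean of `q` over `[α,β]` is at least `μ`:
`𝔼[Z(x,a)] ≤ 𝔼_{τ∼𝒰[α,β]}[F⁻¹_{Z(x,a)}(τ)]`. -/
theorem upper_quantile_mean_overestimates
    (q : ℝ → ℝ) (μ : ℝ)
    (hmono : MonotoneOn q (Set.Icc (0 : ℝ) 1))
    (hint : IntervalIntegrable q MeasureTheory.volume 0 1)
    (hsymm : ∀ τ ∈ Set.Icc (0 : ℝ) 1, q τ + q (1 - τ) = 2 * μ)
    (α β : ℝ) (hα : 1 / 2 ≤ α) (hαβ : α < β) (hβ : β ≤ 1) :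
    (∫ τ in (0 : ℝ)..1, q τ) = μ ∧
      μ ≤ (1 / (β - α)) * ∫ τ in α..β, q τ := by
  have hrefl : ∫ τ in (0 : ℝ)..1, q (1 - τ) = ∫ τ in (0 : ℝ)..1, q τ := by
    simp
  have hint' : IntervalIntegrable (fun τ => q (1 - τ)) MeasureTheory.volume 0 1 := by
    simpa using (hint.comp_sub_left 1).symm
  have hsum : (∫ τ in (0 : ℝ)..1, q τ) + ∫ τ in (0 : ℝ)..1, q (1 - τ) = 2 * μ := by
    rw [← intervalIntegral.integral_add hint hint',
      intervalIntegral.integral_congr (g := fun _ => 2 * μ)]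
    · simp
    · intro τ hτ
      rw [Set.uIcc_of_le zero_le_one] at hτ
      exact hsymm τ hτ
  refine ⟨by linarith, ?_⟩
  have hle : ∀ τ ∈ Set.Icc α β, μ ≤ q τ := by
    intro τ hτ
    have hτ' : τ ∈ Set.Icc (0 : ℝ) 1 := ⟨by linarith [hτ.1], hτ.2.trans hβ⟩
    have hmon : q (1 - τ) ≤ q τ :=
      hmono ⟨by linarith [hτ'.2], by linarith [hτ'.1]⟩ hτ' (by linarith [hτ.1])
    linarith [hsymm τ hτ']
  have hintαβ : IntervalIntegrable q MeasureTheory.volume α β := by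
    refine hint.mono_set ?_
    rw [Set.uIcc_of_le hαβ.le, Set.uIcc_of_le zero_le_one]
    exact Set.Icc_subset_Icc (by linarith) hβ
  have hconst : (∫ _ in α..β, μ) ≤ ∫ τ in α..β, q τ :=
    intervalIntegral.integral_mono_on hαβ.le intervalIntegrable_const hintαβ hle
  rw [intervalIntegral.integral_const, smul_eq_mul] at hconst
  rw [one_div_mul_eq_div, le_div_iff₀ (sub_pos.2 hαβ)]
  linarith
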